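/- arXiv:2202.02353 — 3 statements merged into one kernel-verified Lean document; each statement's English description precedes it below -/
import Mathlib

section
/- Let ε, μ ∈ ℝ, f ∈ ℂ, and let Δ be a 2×2 complex matrix satisfying the C₂zT constraint conj(Δ) = σx · Δ · σx and the parity-even constraint Δᵀ = Δ. Let h = (ε−μ)·1 + (Re f)·σx + (Im f)·σy and H = fromBlocks h Δ Δᴴ (−hᵀ). Then H anticommutes with the chiral-symmetry matrix C = fromBlocks 0 σx (−σx) 0, i.e. C·H + H·C = 0. -/
open Matrix Complex Polynomial

noncomputable section

/-- Pauli matrix σx. -/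
def σx : Matrix (Fin 2) (Fin 2) ℂ := !![0, 1; 1, 0]

/-- Pauli matrix σy. -/
def σy : Matrix (Fin 2) (Fin 2) ℂ := !![0, -Complex.I; Complex.I, 0]

/-- Normal-state block h = (ε−μ)·1 + (Re f)·σx + (Im f)·σy. -/
def hBlock (ε μ : ℝ) (f : ℂ) : Matrix (Fin 2) (Fin 2) ℂ :=
  ((ε - μ : ℝ) : ℂ) • (1 : Matrix (Fin 2) (Fin 2) ℂ) + (f.re : ℂ) • σx + (f.im : ℂ) • σy

/-- Euler-obstructed pairing block Δ∥ = !![conj d∥, 0; 0, d∥]. -/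
def DeltaPar (dp : ℂ) : Matrix (Fin 2) (Fin 2) ℂ := !![(starRingEnd ℂ) dp, 0; 0, dp]

/-- Trivial pairing block Δ⊥ = !![0, d⊥; conj d⊥, 0]. -/
def DeltaPerp (dt : ℂ) : Matrix (Fin 2) (Fin 2) ℂ := !![0, dt; (starRingEnd ℂ) dt, 0]

/-- Bogoliubov–de Gennes matrix H = fromBlocks h Δ Δᴴ (−hᵀ), Δ = Δ∥ + Δ⊥. -/
def BdG (ε μ : ℝ) (f dp dt : ℂ) : Matrix (Fin 2 ⊕ Fin 2) (Fin 2 ⊕ Fin 2) ℂ :=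
  Matrix.fromBlocks (hBlock ε μ f) (DeltaPar dp + DeltaPerp dt)
    (DeltaPar dp + DeltaPerp dt)ᴴ (-(hBlock ε μ f)ᵀ)

/-- BdG matrix with vanishing trivial gap (d⊥ = 0). -/
def BdG0 (ε μ : ℝ) (f dp : ℂ) : Matrix (Fin 2 ⊕ Fin 2) (Fin 2 ⊕ Fin 2) ℂ :=
  BdG ε μ f dp 0

lemma σx_mul_σx : σx * σx = 1 := by
  ext i j
  fin_cases i <;> fin_cases j <;> simp [σx]

lemma hBlock_mul_σx (ε μ : ℝ) (f : ℂ) :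
    hBlock ε μ f * σx = σx * (hBlock ε μ f)ᵀ := by
  ext i j
  fin_cases i <;> fin_cases j <;> simp [hBlock, σx, σy, Matrix.mul_apply, Fin.sum_univ_two]

/-- for a C₂zT-invariant (conj Δ = σx·Δ·σx) parity-even (Δᵀ = Δ)
pairing, the BdG matrix anticommutes with the chiral matrix
C = fromBlocks 0 σx (−σx) 0. -/
theorem stmt4 (ε μ : ℝ) (f : ℂ) (Δ : Matrix (Fin 2) (Fin 2) ℂ)
    (hC2T : Δ.map (starRingEnd ℂ) = σx * Δ * σx)
    (heven : Δᵀ = Δ) :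
    (Matrix.fromBlocks 0 σx (-σx) 0) *
        (Matrix.fromBlocks (hBlock ε μ f) Δ Δᴴ (-(hBlock ε μ f)ᵀ))
      + (Matrix.fromBlocks (hBlock ε μ f) Δ Δᴴ (-(hBlock ε μ f)ᵀ)) *
        (Matrix.fromBlocks 0 σx (-σx) 0) = 0 := by
  have hΔ : Δᴴ = σx * Δ * σx := by
    rw [← hC2T, conjTranspose, heven]
    rfl
  have hleft : σx * Δᴴ = Δ * σx := by
    rw [hΔ, mul_assoc σx, ← mul_assoc, σx_mul_σx, one_mul]
  have hright : Δᴴ * σx = σx * Δ := by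
    rw [hΔ, mul_assoc, σx_mul_σx, mul_one]
  have hσ : (hBlock ε μ f)ᵀ * σx = σx * hBlock ε μ f := by
    have hσx : σx * (hBlock ε μ f * σx) * σx = σx * (σx * (hBlock ε μ f)ᵀ) * σx := by
      rw [hBlock_mul_σx]
    simpa only [mul_assoc, σx_mul_σx, mul_one, ← mul_assoc σx σx, one_mul] using hσx.symm
  simp [Matrix.fromBlocks_multiply, Matrix.fromBlocks_add, hleft, hright, hσ, hBlock_mul_σx]
end
end

section
/- Let μ ∈ ℝ with μ ≠ 0 and let a, b ∈ ℝ. Set P = √(μ² + (a+b)²) and Q = √(μ² + (a−b)²). Then (1/2)·((a+b)²/P − (a−b)²/Q) = a·b·(2/(P+Q))·(1 + μ²/(P·Q)). In particular, the quotient f₋/(a·b) (for a·b ≠ 0) extends continuously across the locus a·b = 0. -/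
/-- with P = √(μ²+(a+b)²) and Q = √(μ²+(a−b)²), μ ≠ 0,
(1/2)·((a+b)²/P − (a−b)²/Q) = a·b·(2/(P+Q))·(1 + μ²/(P·Q)). -/
theorem stmt12 (μ a b : ℝ) (hμ : μ ≠ 0) (P Q : ℝ)
    (hP : P = Real.sqrt (μ ^ 2 + (a + b) ^ 2))
    (hQ : Q = Real.sqrt (μ ^ 2 + (a - b) ^ 2)) :
    (1 / 2) * ((a + b) ^ 2 / P - (a - b) ^ 2 / Q)
      = a * b * (2 / (P + Q)) * (1 + μ ^ 2 / (P * Q)) := by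
  have hP0 : 0 < P := by rw [hP]; positivity
  have hQ0 : 0 < Q := by rw [hQ]; positivity
  have hP2 : P ^ 2 = μ ^ 2 + (a + b) ^ 2 := by rw [hP]; exact Real.sq_sqrt (by positivity)
  have hQ2 : Q ^ 2 = μ ^ 2 + (a - b) ^ 2 := by rw [hQ]; exact Real.sq_sqrt (by positivity)
  have hab : a * b = (P ^ 2 - Q ^ 2) / 4 := by rw [hP2, hQ2]; ring
  have hp : (a + b) ^ 2 = P ^ 2 - μ ^ 2 := by rw [hP2]; ring
  have hq : (a - b) ^ 2 = Q ^ 2 - μ ^ 2 := by rw [hQ2]; ring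
  have hPQ : P + Q ≠ 0 := by positivity
  rw [hab, hp, hq]
  field_simp
  ring
end

section
/- Let μ ∈ ℝ, let H₊', H₋ be Hermitian 2×2 complex matrices, and let Δ' be an arbitrary 2×2 complex matrix. Define h⁺ = fromBlocks (H₊' − μ·1) Δ' (Δ')ᴴ (−(H₋ − μ·1)ᵀ) and h⁻ = fromBlocks (H₋ − μ·1) (−(Δ')ᵀ) (−conj Δ') (−(H₊' − μ·1)ᵀ). Then −h⁻ = ρx · conj(h⁺) · ρx, where ρx = fromBlocks 0 1 1 0 is the 4×4 particle-hole swap. (Interpreting H₊' = h₊(−k), H₋ = h₋(k), Δ' = Δ(−k), this is the particle-hole relation −h_BdG,−(k) = ρx · h_BdG,+*(−k) · ρx, so the gapless nodes of the valley-− BdG Hamiltonian are determined by those of the valley-+ one.) -/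
open Matrix Complex

noncomputable section

/-- Subtracting a real multiple of the identity preserves hermiticity. -/
theorem isHermitian_sub_ofReal_smul_one {n : Type*} [DecidableEq n] {H : Matrix n n ℂ}
    (hH : H.IsHermitian) (μ : ℝ) : (H - (μ : ℂ) • (1 : Matrix n n ℂ)).IsHermitian := by
  refine hH.sub ?_
  simp [Matrix.IsHermitian, Matrix.conjTranspose_smul]

/-- Entrywise conjugation of a Hermitian matrix is transposition. -/
theorem map_conj_eq_transpose {n : Type*} {A : Matrix n n ℂ} (hA : A.IsHermitian) :
    A.map (starRingEnd ℂ) = Aᵀ := by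
  ext i j
  exact hA.apply j i

/-- the particle-hole relation −h⁻ = ρx · conj(h⁺) · ρx between
the valley-− and valley-+ BdG blocks, for Hermitian normal-state blocks. -/
theorem stmt16 (μ : ℝ) (Hp Hm : Matrix (Fin 2) (Fin 2) ℂ) (Δ' : Matrix (Fin 2) (Fin 2) ℂ)
    (hHp : Hp.IsHermitian) (hHm : Hm.IsHermitian) :
    -(Matrix.fromBlocks (Hm - (μ : ℂ) • (1 : Matrix (Fin 2) (Fin 2) ℂ)) (-(Δ'ᵀ))
        (-(Δ'.map (starRingEnd ℂ)))
        (-((Hp - (μ : ℂ) • (1 : Matrix (Fin 2) (Fin 2) ℂ))ᵀ)))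
      = (Matrix.fromBlocks (0 : Matrix (Fin 2) (Fin 2) ℂ) 1 1 0) *
          ((Matrix.fromBlocks (Hp - (μ : ℂ) • (1 : Matrix (Fin 2) (Fin 2) ℂ)) Δ' Δ'ᴴ
              (-((Hm - (μ : ℂ) • (1 : Matrix (Fin 2) (Fin 2) ℂ))ᵀ))).map (starRingEnd ℂ)) *
          (Matrix.fromBlocks (0 : Matrix (Fin 2) (Fin 2) ℂ) 1 1 0) := by
  have hp := map_conj_eq_transpose (isHermitian_sub_ofReal_smul_one hHp μ)
  have hm : (-(Hm - (μ : ℂ) • (1 : Matrix (Fin 2) (Fin 2) ℂ))ᵀ).map (starRingEnd ℂ) =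
      -(Hm - (μ : ℂ) • (1 : Matrix (Fin 2) (Fin 2) ℂ)) := by
    rw [Matrix.map_neg _ (map_neg _),
      map_conj_eq_transpose (isHermitian_sub_ofReal_smul_one hHm μ).transpose,
      Matrix.transpose_transpose]
  have hΔ : Δ'ᴴ.map (starRingEnd ℂ) = Δ'ᵀ := by
    ext i j
    simp
  rw [Matrix.fromBlocks_map, hp, hm, hΔ, Matrix.fromBlocks_multiply, Matrix.fromBlocks_multiply,
    Matrix.fromBlocks_neg]
  simp only [Matrix.zero_mul, Matrix.one_mul, Matrix.mul_zero, Matrix.mul_one, zero_add, add_zero,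
    neg_neg]
end
end
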